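/- Let a, b be rational integers with 2 ≤ a ≤ b−2 and let ρ be the largest real root of x³ − (a+b)x² + abx − 1. An element α ∈ ℤ[ρ] is indecomposable in ℤ[ρ] if and only if there exist a totally positive unit ε of ℤ[ρ] and integers v, w with 0 ≤ v ≤ b−a−1 and va ≤ w ≤ (v+1)a − 1 such that α·ε = −v + (bw+1)ρ − wρ². In particular, the elements −v + (bw+1)ρ − wρ² with 0 ≤ v ≤ b−a−1 and va ≤ w ≤ (v+1)a − 1 are, up to multiplication by totally positive units of ℤ[ρ], all the indecomposable integers in ℤ[ρ]. -/

import Mathlib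

open IntermediateField

noncomputable section

/-- An element of a field `K` is totally positive if its image under every
real embedding of `K` is positive. -/
def TotallyPositive {K : Type*} [Field K] (x : K) : Prop :=
  ∀ φ : K →+* ℝ, 0 < φ x

/-- A totally positive element `α` of an order `O` is (additively) indecomposable in `O`
if it cannot be written as a sum of two totally positive elements of `O`. -/
def IsIndecomposableIn {K : Type*} [Field K] (O : Subalgebra ℤ K) (α : K) : Prop :=
  α ∈ O ∧ TotallyPositive α ∧
    ¬ ∃ β γ : K, β ∈ O ∧ γ ∈ O ∧ TotallyPositive β ∧ TotallyPositive γ ∧ α = β + γ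

/-- The set of totally positive elements of the codifferent of an order `O`. -/
def CodifferentPlus {K : Type*} [Field K] [Algebra ℚ K] (O : Subalgebra ℤ K) : Set K :=
  {δ : K | TotallyPositive δ ∧ ∀ α ∈ O, ∃ n : ℤ, Algebra.trace ℚ K (α * δ) = (n : ℚ)}

lemma lagr (s1 s2 s3 p0 p1 p2 : ℝ) (h12 : s2 < s1) (h23 : s3 < s2)
    (h1 : 0 < p0 + p1 * s1 + p2 * s1 ^ 2) (h2 : p0 + p1 * s2 + p2 * s2 ^ 2 < 0)
    (h3 : 0 < p0 + p1 * s3 + p2 * s3 ^ 2) : 0 < p2 := by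
  have e : p2 * ((s1 - s2) * (s1 - s3) * (s2 - s3)) =
      (p0 + p1 * s1 + p2 * s1 ^ 2) * (s2 - s3) + (-(p0 + p1 * s2 + p2 * s2 ^ 2)) * (s1 - s3)
      + (p0 + p1 * s3 + p2 * s3 ^ 2) * (s1 - s2) := by ring
  have q1 : 0 < s1 - s2 := by linarith
  have q2 : 0 < s2 - s3 := by linarith
  have q3 : 0 < s1 - s3 := by linarith
  have q4 : 0 < -(p0 + p1 * s2 + p2 * s2 ^ 2) := by linarith
  have : 0 < p2 * ((s1 - s2) * (s1 - s3) * (s2 - s3)) := by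
    rw [e]; positivity
  exact pos_of_mul_pos_left this (by positivity)

/-- The element with coordinates `(x, y, z)` in the basis `1, b - r, r (b - r)`. -/
def el {K : Type*} [Field K] (b : ℤ) (r : K) (x y z : ℤ) : K :=
  (x : K) + (y : K) * ((b : K) - r) + (z : K) * (r * ((b : K) - r))

/-- Value of the element at a real place. -/
def vl (b s x y z : ℝ) : ℝ := x + y * (b - s) + z * (s * (b - s))

lemma map_el {K : Type*} [Field K] (b : ℤ) (r : K) (x y z : ℤ) (φ : K →+* ℝ) :
    φ (el b r x y z) = vl b (φ r) x y z := by
  simp [el, vl]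

section places
variable (a b s1 s2 s3 x y z : ℝ) (ha : 2 ≤ a) (hab : a + 2 ≤ b)
  (e1 : s1 * (s1 - a) * (s1 - b) = 1) (e2 : s2 * (s2 - a) * (s2 - b) = 1)
  (e3 : s3 * (s3 - a) * (s3 - b) = 1)
  (h1 : b < s1) (h2 : a - 1 < s2) (h2' : s2 < a) (h3 : 0 < s3) (h3' : a * s3 < 1)
  (v1 : 0 < vl b s1 x y z) (v2 : 0 < vl b s2 x y z) (v3 : 0 < vl b s3 x y z)

include ha hab e1 e2 e3 h1 h2 h2' h3 h3' v1 v2 v3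

lemma M1_pos : 0 < a * x + y := by
  have hs3 : s3 < 1 := by nlinarith
  have key : ∀ s : ℝ, s * (s - a) * (s - b) = 1 → ((s - a) * (a * s - 1)) * vl b s x y z =
      (x * a - y * a + y * a * b + z) + (x * (-1 - a ^ 2) - y * (a + b) - z * a) * s
        + (a * x + y) * s ^ 2 := by
    intro s hs
    unfold vl
    linear_combination (-(a * y) - z * (a * s - 1)) * hs
  apply lagr s1 s2 s3 _ _ _ (by linarith) (by linarith)
  · rw [← key s1 e1]
    have : 0 < s1 - a := by linarith
    have : 0 < a * s1 - 1 := by nlinarith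
    positivity
  · rw [← key s2 e2]
    have : 0 < a * s2 - 1 := by nlinarith
    exact mul_neg_of_neg_of_pos (mul_neg_of_neg_of_pos (by linarith) this) v2
  · rw [← key s3 e3]
    exact mul_pos (mul_pos_of_neg_of_neg (by linarith) (by linarith)) v3

lemma M2_pos : 0 < (b - a + 1) * x - z := by
  have hs3 : s3 < 1 := by nlinarith
  have key : ∀ s : ℝ, s * (s - a) * (s - b) = 1 →
      (1 + (b - a + 1) * (s * (s - a))) * vl b s x y z =
      (x + y * b - (b - a + 1) * y) + (-y + z * b - (b - a + 1) * x * a - (b - a + 1) * z) * s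
        + ((b - a + 1) * x - z) * s ^ 2 := by
    intro s hs
    unfold vl
    linear_combination (-((b - a + 1) * y) - (b - a + 1) * z * s) * hs
  apply lagr s1 s2 s3 _ _ _ (by linarith) (by linarith)
  · rw [← key s1 e1]
    have : 0 < s1 - a := by linarith
    have : 0 < s1 := by linarith
    have : 0 < b - a + 1 := by linarith
    positivity
  · rw [← key s2 e2]
    apply mul_neg_of_neg_of_pos _ v2
    have : (1 + (b - a + 1) * (s2 * (s2 - a))) * (b - s2) = s2 - a + 1 - 2 * (s2 - a + 1) := by
      linear_combination (-(b - a + 1)) * e2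
    have h5 : 0 < b - s2 := by linarith
    by_contra hc
    push Not at hc
    have := mul_nonneg hc h5.le
    linarith
  · rw [← key s3 e3]
    apply mul_pos _ v3
    have : (1 + (b - a + 1) * (s3 * (s3 - a))) * (b - s3) = a - 1 - s3 := by
      linear_combination (-(b - a + 1)) * e3
    have h5 : 0 < b - s3 := by linarith
    exact pos_of_mul_pos_left (this ▸ (by linarith)) h5.le

lemma M3_pos : 0 < x + y := by
  have hs3 : s3 < 1 := by nlinarith
  have key : ∀ s : ℝ, s * (s - a) * (s - b) = 1 → ((s - a) * (s - 1)) * vl b s x y z =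
      (x * a - y + y * a * b + z) + (x * (-1 - a) - y * (a + b) - z) * s
        + (x + y) * s ^ 2 := by
    intro s hs
    unfold vl
    linear_combination (-y - z * (s - 1)) * hs
  apply lagr s1 s2 s3 _ _ _ (by linarith) (by linarith)
  · rw [← key s1 e1]
    have : 0 < s1 - a := by linarith
    have : 0 < s1 - 1 := by linarith
    positivity
  · rw [← key s2 e2]
    exact mul_neg_of_neg_of_pos (mul_neg_of_neg_of_pos (by linarith) (by linarith)) v2
  · rw [← key s3 e3]
    exact mul_pos (mul_pos_of_neg_of_neg (by linarith) (by linarith)) v3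

end places

lemma pos_of_rel (a b s : ℝ) (ha : 0 < a) (hb : 0 < b) (e : s * (s - a) * (s - b) = 1) : 0 < s := by
  by_contra h
  push Not at h
  have : 0 ≤ (s - a) * (s - b) := mul_nonneg_of_nonpos_of_nonpos (by linarith) (by linarith)
  nlinarith

lemma ne_of_rel (a b s : ℝ) (e : s * (s - a) * (s - b) = 1) : s - b ≠ 0 := by
  intro h
  rw [h] at e
  simp at e

lemma comb_pos (n1 n2 n3 p q : ℝ) (h1 : 0 ≤ n1) (h2 : 0 ≤ n2) (h3 : 0 ≤ n3) (hp : 0 < p)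
    (hq : 0 < q) (hn : ¬ (n1 = 0 ∧ n2 = 0 ∧ n3 = 0)) (r : ℝ) (hr : 0 < r) :
    0 < n1 * r + n2 * p + n3 * q := by
  have k1 := mul_nonneg h1 hr.le
  have k2 := mul_nonneg h2 hp.le
  have k3 := mul_nonneg h3 hq.le
  rcases h1.lt_or_eq with h | h
  · have := mul_pos h hr
    linarith
  rcases h2.lt_or_eq with h' | h'
  · have := mul_pos h' hp
    linarith
  rcases h3.lt_or_eq with h'' | h''
  · have := mul_pos h'' hq
    linarith
  exact absurd ⟨h.symm, h'.symm, h''.symm⟩ hn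

lemma cone1_pos (a b s : ℝ) (x y z : ℝ) (ha : 2 ≤ a) (hab : a + 2 ≤ b)
    (e : s * (s - a) * (s - b) = 1)
    (hy : 0 ≤ y) (hz : 0 ≤ a * z + y) (hx : a * z + y ≤ a * (b - a) * x)
    (hn : ¬ (x = 0 ∧ y = 0 ∧ z = 0)) : 0 < vl b s x y z := by
  have hs := pos_of_rel a b s (by linarith) (by linarith) e
  have hne := ne_of_rel a b s e
  have hd : 0 < b - a := by linarith
  have had : 0 < a * (b - a) := by positivity
  have hp : 0 < s * (s - b) ^ 2 := by positivity
  have hq : 0 < (s - a) * (s - b) := by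
    have : 0 < s * ((s - a) * (s - b)) := by rw [← mul_assoc, e]; norm_num
    exact pos_of_mul_pos_right this hs.le
  have id : a * (b - a) * vl b s x y z = (a * (b - a) * x - (a * z + y)) * 1
      + (a * z + y) * (s * (s - b) ^ 2) + ((b - a) * y) * ((s - a) * (s - b)) := by
    unfold vl
    linear_combination (-(a * z + y)) * e
  have : 0 < a * (b - a) * vl b s x y z := by
    rw [id]
    refine comb_pos _ _ _ _ _ (by linarith) hz (by positivity) hp hq ?_ 1 one_pos
    rintro ⟨k1, k2, k3⟩
    have hy0 : y = 0 := by
      rcases mul_eq_zero.mp k3 with h | h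
      · linarith
      · exact h
    subst hy0
    have hz0 : z = 0 := by
      have : a * z = 0 := by linarith
      rcases mul_eq_zero.mp this with h | h
      · linarith
      · exact h
    subst hz0
    have hx0 : x = 0 := by
      have : a * (b - a) * x = 0 := by linarith
      rcases mul_eq_zero.mp this with h | h
      · linarith
      · exact h
    exact hn ⟨hx0, rfl, rfl⟩
  exact pos_of_mul_pos_right this had.le

lemma cone2_pos (a b s : ℝ) (x y z : ℝ) (ha : 2 ≤ a) (hab : a + 2 ≤ b)
    (e : s * (s - a) * (s - b) = 1)
    (hx : 0 ≤ x) (h2 : y ≤ b * ((b - a) * x - z)) (h3 : a * ((b - a) * x - z) ≤ y)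
    (hn : ¬ (x = 0 ∧ y = 0 ∧ z = 0)) : 0 < vl b s x y z := by
  have hs := pos_of_rel a b s (by linarith) (by linarith) e
  have hne := ne_of_rel a b s e
  have hd : 0 < b - a := by linarith
  have hp : 0 < s * (s - b) ^ 2 := by positivity
  have hp2 : 0 < (s - b) ^ 2 := by positivity
  have hq : 0 < (s - a) * (s - b) := by
    have : 0 < s * ((s - a) * (s - b)) := by rw [← mul_assoc, e]; norm_num
    exact pos_of_mul_pos_right this hs.le
  have id : (b - a) * vl b s x y z = ((b - a) * x) * (s * (s - b) ^ 2)
      + (b * ((b - a) * x - z) - y) * ((s - a) * (s - b))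
      + (y - a * ((b - a) * x - z)) * ((s - b) ^ 2) := by
    unfold vl
    linear_combination (-(b - a) * x) * e
  have : 0 < (b - a) * vl b s x y z := by
    rw [id]
    refine comb_pos _ _ _ _ _ (by positivity) (by linarith) (by linarith) hq hp2 ?_ _ hp
    rintro ⟨k1, k2, k3⟩
    have hx0 : x = 0 := by
      rcases mul_eq_zero.mp k1 with h | h
      · linarith
      · exact h
    subst hx0
    have hz0 : z = 0 := by
      have : (b - a) * z = 0 := by linarith
      rcases mul_eq_zero.mp this with h | h
      · linarith
      · exact h
    subst hz0
    exact hn ⟨rfl, by linarith, rfl⟩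
  exact pos_of_mul_pos_right this hd.le

/-- Totally positive units of `O`. -/
def TPU {K : Type*} [Field K] (O : Subalgebra ℤ K) (u : K) : Prop :=
  u ∈ O ∧ (∃ u' ∈ O, u * u' = 1) ∧ TotallyPositive u

section general
variable {K : Type*} [Field K] {O : Subalgebra ℤ K}

lemma TotallyPositive.mul {x y : K} (hx : TotallyPositive x) (hy : TotallyPositive y) :
    TotallyPositive (x * y) := fun φ => by
  rw [map_mul]; exact mul_pos (hx φ) (hy φ)

lemma TotallyPositive.inv' {x y : K} (hx : TotallyPositive x) (hxy : x * y = 1) :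
    TotallyPositive y := fun φ => by
  have h : 0 < φ x * φ y := by rw [← map_mul, hxy]; simp
  exact pos_of_mul_pos_right h (hx φ).le

lemma TPU.one : TPU O (1 : K) := ⟨O.one_mem, ⟨1, O.one_mem, by simp⟩, fun φ => by simp⟩

lemma TPU.mul {u v : K} (hu : TPU O u) (hv : TPU O v) : TPU O (u * v) := by
  obtain ⟨h1, ⟨u', h2, h3⟩, h4⟩ := hu
  obtain ⟨k1, ⟨v', k2, k3⟩, k4⟩ := hv
  refine ⟨O.mul_mem h1 k1, ⟨u' * v', O.mul_mem h2 k2, ?_⟩, h4.mul k4⟩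
  linear_combination v * v' * h3 + k3

lemma TPU.exists_inv {u : K} (hu : TPU O u) : ∃ u', TPU O u' ∧ u * u' = 1 := by
  obtain ⟨h1, ⟨u', h2, h3⟩, h4⟩ := hu
  exact ⟨u', ⟨h2, ⟨u, h1, by rw [mul_comm]; exact h3⟩, h4.inv' h3⟩, h3⟩

lemma indec_mul {u α : K} (hu : TPU O u) (hα : IsIndecomposableIn O α) :
    IsIndecomposableIn O (α * u) := by
  obtain ⟨u', hu', huu⟩ := hu.exists_inv
  refine ⟨O.mul_mem hα.1 hu.1, hα.2.1.mul hu.2.2, ?_⟩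
  rintro ⟨β, γ, hβ, hγ, pβ, pγ, h⟩
  refine hα.2.2 ⟨β * u', γ * u', O.mul_mem hβ hu'.1, O.mul_mem hγ hu'.1,
    pβ.mul hu'.2.2, pγ.mul hu'.2.2, ?_⟩
  linear_combination u' * h - α * huu

end general

section order
variable {K : Type*} [Field K] (a b : ℤ) (r : K)

lemma r_mem : r ∈ Algebra.adjoin ℤ {r} := Algebra.self_mem_adjoin_singleton ℤ r

lemma int_mem (n : ℤ) : (n : K) ∈ Algebra.adjoin ℤ {r} := by
  exact (Algebra.adjoin ℤ {r}).algebraMap_mem n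

lemma el_mem (x y z : ℤ) : el b r x y z ∈ Algebra.adjoin ℤ {r} := by
  have hB : (b : K) - r ∈ Algebra.adjoin ℤ {r} := Subalgebra.sub_mem _ (int_mem r b) (r_mem r)
  exact Subalgebra.add_mem _ (Subalgebra.add_mem _ (int_mem r x)
    (Subalgebra.mul_mem _ (int_mem r y) hB))
    (Subalgebra.mul_mem _ (int_mem r z) (Subalgebra.mul_mem _ (r_mem r) hB))

variable (hr : r * (r - a) * (r - b) = 1)
include hr

lemma mul_r (x y z : ℤ) : el b r x y z * r = el b r (b * x - z) (-x) (y + a * z) := by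
  simp only [el]; push_cast; linear_combination (-(z : K)) * hr

lemma mul_rinv (x y z : ℤ) : el b r x y z * ((r - a) * (r - b)) =
    el b r (-y) (a * x + a * b * y + z) (-x - b * y) := by
  simp only [el]; push_cast; linear_combination (-(y : K) - z * (r - b) - z * b + z * b) * hr

lemma mul_eps (x y z : ℤ) : el b r x y z * (r * (r - b) ^ 2) =
    el b r (x + (b - a) * y + (b - a) * a * z) (y - (b - a) * z)
      (z + (b - a) * x + (b - a) ^ 2 * y + (b - a) ^ 2 * a * z) := by
  have h1 : r * (r - b) ^ 2 = 1 + (b - a) * (r * (b - r)) := by linear_combination hr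
  rw [h1]
  simp only [el]; push_cast
  linear_combination ((b - a) * (y + z * (a - (b - r)))) * hr

lemma mul_epsinv (x y z : ℤ) : el b r x y z * (r * (r - a) ^ 2) =
    el b r ((1 + (b - a) ^ 2 * b) * x - (b - a) * y - (b - a) * b * z)
      (-(b - a) ^ 2 * x + y + (b - a) * z) (-(b - a) * x + z) := by
  have h := mul_eps a b r hr ((1 + (b - a) ^ 2 * b) * x - (b - a) * y - (b - a) * b * z)
      (-(b - a) ^ 2 * x + y + (b - a) * z) (-(b - a) * x + z)
  have e : el b r x y z = el b r ((1 + (b - a) ^ 2 * b) * x - (b - a) * y - (b - a) * b * z)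
      (-(b - a) ^ 2 * x + y + (b - a) * z) (-(b - a) * x + z) * (r * (r - b) ^ 2) := by
    rw [h]; congr 1 <;> ring
  rw [e]
  have h1 : (r * (r - b) ^ 2) * (r * (r - a) ^ 2) = 1 := by
    linear_combination (r * (r - a) * (r - b) + 1) * hr
  rw [mul_assoc, h1, mul_one]

lemma exists_el {α : K} (h : α ∈ Algebra.adjoin ℤ {r}) : ∃ x y z, α = el b r x y z := by
  induction h using Algebra.adjoin_induction with
  | mem x hx =>
    rw [Set.mem_singleton_iff] at hx
    exact ⟨b, -1, 0, by simp [el, hx]⟩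
  | algebraMap n => exact ⟨n, 0, 0, by simp [el]⟩
  | add p q _ _ hp hq =>
    obtain ⟨x, y, z, rfl⟩ := hp
    obtain ⟨x', y', z', rfl⟩ := hq
    exact ⟨x + x', y + y', z + z', by simp only [el]; push_cast; ring⟩
  | mul p q _ _ hp hq =>
    obtain ⟨x, y, z, rfl⟩ := hp
    obtain ⟨x', y', z', rfl⟩ := hq
    have e1 := mul_r a b r hr x y z
    have e2 := mul_r a b r hr (b * x - z) (-x) (y + a * z)
    have : el b r x y z * el b r x' y' z' = (x' + b * y') * el b r x y z
      + (z' * b - y') * (el b r x y z * r) - z' * (el b r x y z * r * r) := by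
      conv_lhs => rhs; unfold el
      ring
    rw [this, e1, e2]
    refine ⟨(x' + b * y') * x + (z' * b - y') * (b * x - z)
        - z' * (b * (b * x - z) - (y + a * z)),
      (x' + b * y') * y + (z' * b - y') * (-x) - z' * (-(b * x - z)),
      (x' + b * y') * z + (z' * b - y') * (y + a * z) - z' * (-x + a * (y + a * z)), ?_⟩
    simp only [el]; push_cast; ring

end order

section units
variable {K : Type*} [Field K] (a b : ℤ) (r : K) (ha : 2 ≤ a) (hab : a ≤ b - 2)
  (hr : r * (r - a) * (r - b) = 1)
include hr

lemma rel_map (φ : K →+* ℝ) : φ r * (φ r - a) * (φ r - b) = 1 := by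
  have := congrArg φ hr
  simpa using this

include ha hab

lemma tpu_r : TPU (Algebra.adjoin ℤ {r}) r := by
  refine ⟨r_mem r, ⟨(r - a) * (r - b), ?_, by rw [← mul_assoc]; exact hr⟩, fun φ => ?_⟩
  · exact Subalgebra.mul_mem _ (Subalgebra.sub_mem _ (r_mem r) (int_mem r a))
      (Subalgebra.sub_mem _ (r_mem r) (int_mem r b))
  · refine pos_of_rel a b _ ?_ ?_ (rel_map a b r hr φ)
    · exact_mod_cast (by linarith : 0 < a)
    · exact_mod_cast (by linarith : 0 < b)

lemma tpu_rinv : TPU (Algebra.adjoin ℤ {r}) ((r - a) * (r - b)) := by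
  obtain ⟨u', h1, h2⟩ := (tpu_r a b r ha hab hr).exists_inv
  have : (r - a) * (r - b) = u' := by
    linear_combination u' * hr - (r - a) * (r - b) * h2
  rw [this]; exact h1

lemma tpu_eps : TPU (Algebra.adjoin ℤ {r}) (r * (r - b) ^ 2) := by
  refine ⟨?_, ⟨r * (r - a) ^ 2, ?_, ?_⟩, fun φ => ?_⟩
  · exact Subalgebra.mul_mem _ (r_mem r)
      (Subalgebra.pow_mem _ (Subalgebra.sub_mem _ (r_mem r) (int_mem r b)) 2)
  · exact Subalgebra.mul_mem _ (r_mem r)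
      (Subalgebra.pow_mem _ (Subalgebra.sub_mem _ (r_mem r) (int_mem r a)) 2)
  · linear_combination (r * (r - a) * (r - b) + 1) * hr
  · have h1 := (tpu_r a b r ha hab hr).2.2 φ
    have h2 := ne_of_rel a b _ (rel_map a b r hr φ)
    simp only [map_mul, map_pow, map_sub, map_intCast]
    positivity

lemma tpu_epsinv : TPU (Algebra.adjoin ℤ {r}) (r * (r - a) ^ 2) := by
  obtain ⟨u', h1, h2⟩ := (tpu_eps a b r ha hab hr).exists_inv
  have h3 : (r * (r - b) ^ 2) * (r * (r - a) ^ 2) = 1 := by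
    linear_combination (r * (r - a) * (r - b) + 1) * hr
  have : (r * (r - a) ^ 2) = u' := by
    linear_combination u' * h3 - (r * (r - a) ^ 2) * h2
  rw [this]; exact h1

lemma tp_cone1 (x y z : ℤ) (hy : 0 ≤ y) (hz : 0 ≤ a * z + y) (hx : a * z + y ≤ a * (b - a) * x)
    (hn : ¬ (x = 0 ∧ y = 0 ∧ z = 0)) : TotallyPositive (el b r x y z) := fun φ => by
  rw [map_el]
  apply cone1_pos a b _ x y z _ _ (rel_map a b r hr φ)
  · exact_mod_cast hy
  · exact_mod_cast hz
  · exact_mod_cast hx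
  · exact_mod_cast hn
  · exact_mod_cast ha
  · exact_mod_cast (by linarith : a + 2 ≤ b)

lemma tp_cone2 (x y z : ℤ) (hx : 0 ≤ x) (h2 : y ≤ b * ((b - a) * x - z))
    (h3 : a * ((b - a) * x - z) ≤ y)
    (hn : ¬ (x = 0 ∧ y = 0 ∧ z = 0)) : TotallyPositive (el b r x y z) := fun φ => by
  rw [map_el]
  apply cone2_pos a b _ x y z _ _ (rel_map a b r hr φ)
  · exact_mod_cast hx
  · exact_mod_cast h2
  · exact_mod_cast h3
  · exact_mod_cast hn
  · exact_mod_cast ha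
  · exact_mod_cast (by linarith : a + 2 ≤ b)

end units

/-- Existence of three real places in the expected position. -/
def Places {K : Type*} [Field K] (a b : ℤ) (r : K) : Prop :=
  ∃ φ1 φ2 φ3 : K →+* ℝ, (b : ℝ) < φ1 r ∧ (a : ℝ) - 1 < φ2 r ∧ φ2 r < a ∧ 0 < φ3 r ∧
    (a : ℝ) * φ3 r < 1

section main
variable {K : Type*} [Field K] (a b : ℤ) (r : K) (ha : 2 ≤ a) (hab : a ≤ b - 2)
  (hr : r * (r - a) * (r - b) = 1) (hP : Places a b r)
include ha hab hr hP

lemma functionals (x y z : ℤ) (h : TotallyPositive (el b r x y z)) :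
    0 < a * x + y ∧ 0 < (b - a + 1) * x - z ∧ 0 < x + y ∧
    ∃ s : ℝ, (a : ℝ) - 1 < s ∧ s < a ∧ 0 < vl b s x y z := by
  obtain ⟨φ1, φ2, φ3, h1, h2, h2b, h3, h3'⟩ := hP
  have v1 := h φ1
  have v2 := h φ2
  have v3 := h φ3
  rw [map_el] at v1 v2 v3
  have e1 := rel_map a b r hr φ1
  have e2 := rel_map a b r hr φ2
  have e3 := rel_map a b r hr φ3
  have ha' : (2 : ℝ) ≤ a := by exact_mod_cast ha
  have hab' : (a : ℝ) + 2 ≤ b := by exact_mod_cast (by linarith : a + 2 ≤ b)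
  have k1 := M1_pos a b _ _ _ x y z ha' hab' e1 e2 e3 h1 h2 h2b h3 h3' v1 v2 v3
  have k2 := M2_pos a b _ _ _ x y z ha' hab' e1 e2 e3 h1 h2 h2b h3 h3' v1 v2 v3
  have k3 := M3_pos a b _ _ _ x y z ha' hab' e1 e2 e3 h1 h2 h2b h3 h3' v1 v2 v3
  exact ⟨by exact_mod_cast k1, by exact_mod_cast k2, by exact_mod_cast k3, _, h2, h2b, v2⟩

/-- No totally positive `(x,y,z)` with `x ≤ 0` is dominated by `(1,t,v)`. -/
lemma no_dec (t v x y z : ℤ) (ht : t ≤ a - 1) (hx : x ≤ 0)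
    (hβ : TotallyPositive (el b r x y z))
    (hγ : TotallyPositive (el b r (1 - x) (t - y) (v - z))) : False := by
  obtain ⟨-, k2, -, s, hs1, hs2, hs3⟩ := functionals a b r ha hab hr hP _ _ _ hβ
  obtain ⟨-, -, k3, -⟩ := functionals a b r ha hab hr hP _ _ _ hγ
  have hz : (b - a + 1) * (-x) + 1 ≤ -z := by linarith
  have hz3 : 3 * (-x) + 1 ≤ -z := by nlinarith
  have hy : y ≤ -x + a - 1 := by linarith
  have ha' : (2 : ℝ) ≤ a := by exact_mod_cast ha
  have hab' : (a : ℝ) + 2 ≤ b := by exact_mod_cast (by linarith : a + 2 ≤ b)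
  have hx' : (x : ℝ) ≤ 0 := by exact_mod_cast hx
  have hz3' : 3 * (-(x : ℝ)) + 1 ≤ -z := by exact_mod_cast hz3
  have hy' : (y : ℝ) ≤ -x + a - 1 := by exact_mod_cast hy
  unfold vl at hs3
  have h5 : 0 < b - s := by linarith
  have h6 : 0 < (y + z * s) * (b - s) := by nlinarith
  have h7 : 0 < y + z * s := pos_of_mul_pos_left h6 h5.le
  have h8 : (3 * (-(x : ℝ)) + 1) * (a - 1) ≤ (-z) * s :=
    mul_le_mul hz3' hs1.le (by linarith) (by linarith)
  nlinarith

lemma list_indec (t v : ℤ) (ht0 : 0 ≤ t) (ht : t ≤ a - 1) (hv0 : 0 ≤ v) (hv : v ≤ b - a - 1) :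
    IsIndecomposableIn (Algebra.adjoin ℤ {r}) (el b r 1 t v) := by
  refine ⟨el_mem b r _ _ _, ?_, ?_⟩
  · apply tp_cone1 a b r ha hab hr
    · exact ht0
    · nlinarith
    · nlinarith
    · omega
  · rintro ⟨β, γ, hβ, hγ, pβ, pγ, h⟩
    obtain ⟨x, y, z, rfl⟩ := exists_el a b r hr hβ
    have hγ' : γ = el b r (1 - x) (t - y) (v - z) := by
      have : γ = el b r 1 t v - el b r x y z := by rw [h]; ring
      rw [this]; simp only [el]; push_cast; ring
    rw [hγ'] at pγ
    by_cases hx : x ≤ 0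
    · exact no_dec a b r ha hab hr hP t v x y z ht hx pβ pγ
    · apply no_dec a b r ha hab hr hP t v (1 - x) (t - y) (v - z) ht (by omega) pγ
      convert pβ using 2 <;> ring

/-- The right-hand side of the theorem. -/
def Good (a b : ℤ) (r : K) (α : K) : Prop :=
  ∃ u, TPU (Algebra.adjoin ℤ {r}) u ∧ ∃ t v : ℤ, 0 ≤ t ∧ t ≤ a - 1 ∧ 0 ≤ v ∧ v ≤ b - a - 1 ∧
    α * u = el b r 1 t v

omit hP in
lemma good_of_unit {α u e : K} (hu : TPU (Algebra.adjoin ℤ {r}) u)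
    (he : TPU (Algebra.adjoin ℤ {r}) e) (h : α * u = e) : Good a b r α := by
  obtain ⟨e', h1, h2⟩ := he.exists_inv
  refine ⟨u * e', hu.mul h1, 0, 0, le_rfl, by linarith, le_rfl, by linarith, ?_⟩
  rw [← mul_assoc, h, h2]; simp [el]

omit ha hab hr hP in
lemma sub_unit {β e : K} (hβ : IsIndecomposableIn (Algebra.adjoin ℤ {r}) β)
    (he : TPU (Algebra.adjoin ℤ {r}) e) (x y z : ℤ) (hs : β = el b r x y z + e)
    (h : ¬ (x = 0 ∧ y = 0 ∧ z = 0) → TotallyPositive (el b r x y z)) : β = e := by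
  by_cases h0 : x = 0 ∧ y = 0 ∧ z = 0
  · obtain ⟨rfl, rfl, rfl⟩ := h0
    rw [hs]; simp [el]
  · exact absurd ⟨_, _, el_mem b r x y z, he.1, h h0, he.2.2, hs⟩ hβ.2.2

lemma good_cone1 {α u : K} (hu : TPU (Algebra.adjoin ℤ {r}) u)
    (hα : IsIndecomposableIn (Algebra.adjoin ℤ {r}) α) (x y z : ℤ) (h : α * u = el b r x y z)
    (hy : 0 ≤ y) (hz : 0 ≤ a * z + y) (hx : a * z + y ≤ a * (b - a) * x) : Good a b r α := by
  have hβ := indec_mul hu hα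
  have hpos := hβ.2.1
  rw [h] at hpos
  obtain ⟨k1, -, k3, -⟩ := functionals a b r ha hab hr hP _ _ _ hpos
  by_cases c3 : a ≤ y
  · refine good_of_unit a b r ha hab hr hu (tpu_rinv a b r ha hab hr)
      (sub_unit b r hβ (tpu_rinv a b r ha hab hr) x (y - a) (z + 1) ?_ ?_)
    · rw [h]; simp only [el]; push_cast; ring
    · exact tp_cone1 a b r ha hab hr _ _ _ (by linarith) (by linarith) (by linarith)
  by_cases c2 : a * (b - a) ≤ a * z + y
  · refine good_of_unit a b r ha hab hr hu (tpu_eps a b r ha hab hr)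
      (sub_unit b r hβ (tpu_eps a b r ha hab hr) (x - 1) y (z - (b - a)) ?_ ?_)
    · rw [h]; simp only [el]; push_cast; linear_combination (-1 : K) * hr
    · exact tp_cone1 a b r ha hab hr _ _ _ (by linarith) (by linarith) (by linarith)
  by_cases c1 : a * (b - a) ≤ a * (b - a) * x - (a * z + y)
  · refine good_of_unit a b r ha hab hr hu TPU.one
      (sub_unit b r hβ TPU.one (x - 1) y z ?_ ?_)
    · rw [h]; simp only [el]; push_cast; ring
    · exact tp_cone1 a b r ha hab hr _ _ _ (by linarith) (by linarith) (by linarith)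
  push Not at c1 c2 c3
  have hd : 0 < a * (b - a) := mul_pos (by linarith) (by linarith)
  have hx2 : x < 2 := by
    by_contra hc
    push Not at hc
    have := mul_le_mul_of_nonneg_left hc hd.le
    linarith
  have hx0 : 0 ≤ x := by
    by_contra hc
    push Not at hc
    have := mul_neg_of_pos_of_neg hd hc
    linarith
  have hz0 : 0 ≤ z := by
    by_contra hc
    push Not at hc
    have : a * z ≤ a * (-1) := mul_le_mul_of_nonneg_left (by linarith) (by linarith)
    linarith
  have hz1 : z ≤ b - a - 1 := by
    by_contra hc
    push Not at hc
    have : a * (b - a) ≤ a * z := mul_le_mul_of_nonneg_left (by linarith) (by linarith)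
    linarith
  have hx1 : x = 1 := by
    by_contra hc
    have hx00 : x = 0 := by omega
    subst hx00
    have : 0 ≤ a * z := mul_nonneg (by linarith) hz0
    linarith
  subst hx1
  exact ⟨u, hu, y, z, hy, by linarith, hz0, hz1, h⟩

lemma good_cone2 {α u : K} (hu : TPU (Algebra.adjoin ℤ {r}) u)
    (hα : IsIndecomposableIn (Algebra.adjoin ℤ {r}) α) (x y z : ℤ) (h : α * u = el b r x y z)
    (hx : 0 ≤ x) (h2 : y ≤ b * ((b - a) * x - z)) (h3 : a * ((b - a) * x - z) ≤ y) :
    Good a b r α := by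
  have hβ := indec_mul hu hα
  have hpos := hβ.2.1
  rw [h] at hpos
  obtain ⟨k1, k2, k3, -⟩ := functionals a b r ha hab hr hP _ _ _ hpos
  by_cases c1 : 1 ≤ x
  · refine good_of_unit a b r ha hab hr hu (tpu_eps a b r ha hab hr)
      (sub_unit b r hβ (tpu_eps a b r ha hab hr) (x - 1) y (z - (b - a)) ?_ ?_)
    · rw [h]; simp only [el]; push_cast; linear_combination (-1 : K) * hr
    · exact tp_cone2 a b r ha hab hr _ _ _ (by linarith) (by linarith) (by linarith)
  have hx0 : x = 0 := by omega
  subst hx0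
  have he : TPU (Algebra.adjoin ℤ {r}) ((r * (r - b) ^ 2) * ((r - a) * (r - b))) :=
    (tpu_eps a b r ha hab hr).mul (tpu_rinv a b r ha hab hr)
  by_cases c3 : b - a ≤ y + a * z
  · refine good_of_unit a b r ha hab hr hu he
      (sub_unit b r hβ he 0 (y - b) (z + 1) ?_ ?_)
    · rw [h]; simp only [el]; push_cast; linear_combination (-(r - b) ^ 2) * hr
    · exact tp_cone2 a b r ha hab hr _ _ _ (by linarith) (by linarith) (by linarith)
  by_cases c2 : b - a ≤ - b * z - y
  · refine good_of_unit a b r ha hab hr hu (tpu_rinv a b r ha hab hr)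
      (sub_unit b r hβ (tpu_rinv a b r ha hab hr) 0 (y - a) (z + 1) ?_ ?_)
    · rw [h]; simp only [el]; push_cast; ring
    · exact tp_cone2 a b r ha hab hr _ _ _ (by linarith) (by linarith) (by linarith)
  push Not at c2 c3
  have hz : z = -1 := by
    have : z < 0 := by linarith
    have : -2 < z := by
      by_contra hc
      push Not at hc
      have : (b - a) * z ≤ (b - a) * (-2) := mul_le_mul_of_nonneg_left hc (by linarith)
      linarith
    omega
  subst hz
  refine ⟨u * r, hu.mul (tpu_r a b r ha hab hr), 0, y - a, le_rfl, by linarith, by linarith,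
    by linarith, ?_⟩
  rw [← mul_assoc, h, mul_r a b r hr]
  congr 1 <;> ring

lemma good_of_indec {α : K} (hα : IsIndecomposableIn (Algebra.adjoin ℤ {r}) α) :
    Good a b r α := by
  classical
  let P : ℕ → Prop := fun n => ∃ u x y z, TPU (Algebra.adjoin ℤ {r}) u ∧ α * u = el b r x y z ∧
    ((n : ℤ) = a * x + y ∨ (n : ℤ) = a * ((b - a + 1) * x - z))
  have hpos : ∀ u x y z, TPU (Algebra.adjoin ℤ {r}) u → α * u = el b r x y z →
      0 < a * x + y ∧ 0 < a * ((b - a + 1) * x - z) := by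
    intro u x y z hu h
    have := hα.2.1.mul hu.2.2
    rw [h] at this
    obtain ⟨k1, k2, -⟩ := functionals a b r ha hab hr hP _ _ _ this
    exact ⟨k1, mul_pos (by linarith) k2⟩
  have hex : ∃ n, P n := by
    obtain ⟨x, y, z, h⟩ := exists_el a b r hr hα.1
    have h' : α * 1 = el b r x y z := by rw [mul_one, h]
    refine ⟨(a * x + y).toNat, 1, x, y, z, TPU.one, h', Or.inl ?_⟩
    exact Int.toNat_of_nonneg (hpos _ _ _ _ TPU.one h').1.le
  have hmin1 : ∀ u x y z, TPU (Algebra.adjoin ℤ {r}) u → α * u = el b r x y z →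
      (Nat.find hex : ℤ) ≤ a * x + y := by
    intro u x y z hu h
    have h0 := Int.toNat_of_nonneg (hpos _ _ _ _ hu h).1.le
    have := Nat.find_min' hex (m := (a * x + y).toNat) ⟨u, x, y, z, hu, h, Or.inl h0⟩
    rw [← h0]; exact_mod_cast this
  have hmin2 : ∀ u x y z, TPU (Algebra.adjoin ℤ {r}) u → α * u = el b r x y z →
      (Nat.find hex : ℤ) ≤ a * ((b - a + 1) * x - z) := by
    intro u x y z hu h
    have h0 := Int.toNat_of_nonneg (hpos _ _ _ _ hu h).2.le
    have := Nat.find_min' hex (m := (a * ((b - a + 1) * x - z)).toNat)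
      ⟨u, x, y, z, hu, h, Or.inr h0⟩
    rw [← h0]; exact_mod_cast this
  obtain ⟨u, x, y, z, hu, h, hn⟩ := Nat.find_spec hex
  have pa : 0 < a * a - a - 1 := by nlinarith
  have pd : 0 < a * (b - a) - 1 := by nlinarith
  rcases hn with hn | hn
  · have q1 := hmin2 u x y z hu h
    have q2 := hmin2 _ _ _ _ (hu.mul (tpu_rinv a b r ha hab hr))
      (by rw [← mul_assoc, h, mul_rinv a b r hr])
    have q3 := hmin2 _ _ _ _ (hu.mul (tpu_eps a b r ha hab hr))
      (by rw [← mul_assoc, h, mul_eps a b r hr])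
    rw [hn] at q1 q2 q3
    apply good_cone1 a b r ha hab hr hP hu hα x y z h
    · have : 0 ≤ (a * a - a - 1) * y := by linarith
      exact nonneg_of_mul_nonneg_right this pa
    · have : 0 ≤ (a * (b - a) - 1) * (a * z + y) := by linarith
      exact nonneg_of_mul_nonneg_right this pd
    · linarith
  · have q1 := hmin1 u x y z hu h
    have q2 := hmin1 _ _ _ _ (hu.mul (tpu_r a b r ha hab hr))
      (by rw [← mul_assoc, h, mul_r a b r hr])
    have q3 := hmin1 _ _ _ _ (hu.mul (tpu_epsinv a b r ha hab hr))
      (by rw [← mul_assoc, h, mul_epsinv a b r hr])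
    rw [hn] at q1 q2 q3
    apply good_cone2 a b r ha hab hr hP hu hα x y z h
    · have : 0 ≤ (a * a - a - 1) * x := by linarith
      exact nonneg_of_mul_nonneg_right this pa
    · have : 0 ≤ (a * (b - a) - 1) * (b * ((b - a) * x - z) - y) := by linarith
      have := nonneg_of_mul_nonneg_right this pd
      linarith
    · linarith

omit ha hab hP in
lemma list_form (t v : ℤ) : el b r 1 t v * r = -((v : ℤ) : K)
    + ((b * (v * a + t) + 1 : ℤ) : K) * r - ((v * a + t : ℤ) : K) * r ^ 2 := by
  rw [mul_r a b r hr]; simp only [el]; push_cast; ring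

theorem main_gen (α : K) :
    IsIndecomposableIn (Algebra.adjoin ℤ {r}) α ↔
      ∃ ε : K, ε ∈ Algebra.adjoin ℤ {r} ∧
        (∃ ε' ∈ Algebra.adjoin ℤ {r}, ε * ε' = 1) ∧
        TotallyPositive ε ∧
        ∃ v w : ℤ, 0 ≤ v ∧ v ≤ b - a - 1 ∧ v * a ≤ w ∧ w ≤ (v + 1) * a - 1 ∧
          α * ε = -((v : ℤ) : K) + ((b * w + 1 : ℤ) : K) * r - ((w : ℤ) : K) * r ^ 2 := by
  constructor
  · intro hα
    obtain ⟨u, hu, t, v, h1, h2, h3, h4, h5⟩ := good_of_indec a b r ha hab hr hP hα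
    obtain ⟨k1, k2, k3⟩ := hu.mul (tpu_r a b r ha hab hr)
    refine ⟨u * r, k1, k2, k3, v, v * a + t, h3, h4, by linarith, by linarith, ?_⟩
    rw [← mul_assoc, h5, list_form a b r hr]
  · rintro ⟨ε, h1, h2, h3, v, w, hv, hv', hw, hw', h⟩
    have hε : TPU (Algebra.adjoin ℤ {r}) ε := ⟨h1, h2, h3⟩
    have hl := list_form a b r hr (w - v * a) v
    rw [show v * a + (w - v * a) = w by ring, ← h] at hl
    have hi := indec_mul (tpu_r a b r ha hab hr)
      (list_indec a b r ha hab hr hP (w - v * a) v (by linarith) (by linarith) hv hv')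
    rw [hl] at hi
    obtain ⟨ε', k1, k2⟩ := hε.exists_inv
    have := indec_mul k1 hi
    rwa [mul_assoc, k2, mul_one] at this

end main

lemma exists_roots (a b : ℝ) (ha : 2 ≤ a) (hab : a + 2 ≤ b) :
    ∃ s1 s2 s3 : ℝ, s1 * (s1 - a) * (s1 - b) = 1 ∧ s2 * (s2 - a) * (s2 - b) = 1 ∧
      s3 * (s3 - a) * (s3 - b) = 1 ∧ b < s1 ∧ a - 1 < s2 ∧ s2 < a ∧ 0 < s3 ∧ a * s3 < 1 := by
  have hc : Continuous fun s : ℝ => s * (s - a) * (s - b) := by fun_prop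
  obtain ⟨s1, ⟨h1, -⟩, e1⟩ := intermediate_value_Ioo (show b ≤ b + 1 by linarith)
    hc.continuousOn (show (1 : ℝ) ∈ _ from ⟨by simp, by nlinarith⟩)
  obtain ⟨s2, ⟨h2, h2'⟩, e2⟩ := intermediate_value_Ioo' (show a - 1 ≤ a by linarith)
    hc.continuousOn (show (1 : ℝ) ∈ _ from ⟨by simp, by nlinarith⟩)
  have hia : 0 < 1 / a := by positivity
  have hval : 1 < 1 / a * (1 / a - a) * (1 / a - b) := by
    have h1 : 1 / a ≤ 1 / 2 := one_div_le_one_div_of_le (by norm_num) ha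
    have h2 : 1 / a * (1 / a - a) * (1 / a - b) = (1 - (1 / a) ^ 2) * (b - 1 / a) := by
      field_simp; ring
    rw [h2]
    have h3 : (1 / a) ^ 2 ≤ 1 / 4 := by nlinarith
    nlinarith
  obtain ⟨s3, ⟨h3, h3'⟩, e3⟩ := intermediate_value_Ioo hia.le
    hc.continuousOn (show (1 : ℝ) ∈ _ from ⟨by simp, hval⟩)
  refine ⟨s1, s2, s3, e1, e2, e3, h1, h2, h2', h3, ?_⟩
  rw [lt_div_iff₀ (by linarith)] at h3'
  linarith

open Polynomial in
lemma exists_hom (a b : ℤ) (ρ : ℝ) (hroot : ρ * (ρ - a) * (ρ - b) = 1)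
    (hdeg : Module.finrank ℚ ℚ⟮ρ⟯ = 3) (s : ℝ) (hs : s * (s - a) * (s - b) = 1) :
    ∃ φ : ℚ⟮ρ⟯ →+* ℝ, φ (AdjoinSimple.gen ℚ ρ) = s := by
  let f : ℚ[X] := X * (X - C (a : ℚ)) * (X - C (b : ℚ)) - 1
  have hval : ∀ t : ℝ, aeval t f = t * (t - a) * (t - b) - 1 := by
    intro t; simp [f]
  have hfd : f.natDegree = 3 := by simp only [f]; compute_degree!
  have hfm : f.Monic := by simp only [f]; monicity!
  have hint : IsIntegral ℚ ρ := ⟨f, hfm, by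
    have := hval ρ
    rw [hroot, sub_self] at this
    exact this⟩
  have hmin : minpoly ℚ ρ = f := by
    symm
    apply Polynomial.eq_of_monic_of_dvd_of_natDegree_le (minpoly.monic hint) hfm
    · exact minpoly.dvd ℚ ρ (by rw [hval, hroot, sub_self])
    · rw [hfd, ← IntermediateField.adjoin.finrank hint, hdeg]
  have hsm : s ∈ (minpoly ℚ ρ).aroots ℝ := by
    rw [hmin, mem_aroots]
    exact ⟨hfm.ne_zero, by rw [hval, hs, sub_self]⟩
  refine ⟨((algHomAdjoinIntegralEquiv ℚ hint).symm ⟨s, hsm⟩ : ℚ⟮ρ⟯ →ₐ[ℚ] ℝ), ?_⟩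
  exact algHomAdjoinIntegralEquiv_symm_apply_gen ℚ hint ⟨s, hsm⟩

/-- Let `2 ≤ a ≤ b−2` and `ρ` the largest real root of
`x³ − (a+b)x² + abx − 1`. An element `α ∈ ℤ[ρ]` is indecomposable in `ℤ[ρ]` if and only
if there exist a totally positive unit `ε` of `ℤ[ρ]` and integers `v, w` with
`0 ≤ v ≤ b−a−1` and `va ≤ w ≤ (v+1)a−1` such that `α·ε = −v + (bw+1)ρ − wρ²`. -/
theorem stmt_13 (a b : ℤ) (ha : 2 ≤ a) (hab : a ≤ b - 2)
    (ρ : ℝ) (hroot : ρ ^ 3 - ((a : ℝ) + (b : ℝ)) * ρ ^ 2 + (a : ℝ) * (b : ℝ) * ρ - 1 = 0)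
    (hmax : ∀ x : ℝ, x ^ 3 - ((a : ℝ) + (b : ℝ)) * x ^ 2 + (a : ℝ) * (b : ℝ) * x - 1 = 0 → x ≤ ρ)
    (hdeg : Module.finrank ℚ ℚ⟮ρ⟯ = 3)
    (α : ℚ⟮ρ⟯) (hmem : α ∈ Algebra.adjoin ℤ {AdjoinSimple.gen ℚ ρ}) :
    IsIndecomposableIn (Algebra.adjoin ℤ {AdjoinSimple.gen ℚ ρ}) α ↔
      ∃ ε : ℚ⟮ρ⟯, ε ∈ Algebra.adjoin ℤ {AdjoinSimple.gen ℚ ρ} ∧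
        (∃ ε' ∈ Algebra.adjoin ℤ {AdjoinSimple.gen ℚ ρ}, ε * ε' = 1) ∧
        TotallyPositive ε ∧
        ∃ v w : ℤ, 0 ≤ v ∧ v ≤ b - a - 1 ∧ v * a ≤ w ∧ w ≤ (v + 1) * a - 1 ∧
          α * ε = -((v : ℤ) : ℚ⟮ρ⟯)
            + ((b * w + 1 : ℤ) : ℚ⟮ρ⟯) * AdjoinSimple.gen ℚ ρ
            - ((w : ℤ) : ℚ⟮ρ⟯) * AdjoinSimple.gen ℚ ρ ^ 2 := by
  have h1 : ρ * (ρ - a) * (ρ - b) = 1 := by linear_combination hroot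
  have hr : AdjoinSimple.gen ℚ ρ * (AdjoinSimple.gen ℚ ρ - a) * (AdjoinSimple.gen ℚ ρ - b)
      = 1 := by
    apply Subtype.ext
    push_cast
    rw [AdjoinSimple.coe_gen]
    exact h1
  apply main_gen a b (AdjoinSimple.gen ℚ ρ) ha hab hr
  obtain ⟨s1, s2, s3, e1, e2, e3, k⟩ := exists_roots a b (by exact_mod_cast ha)
    (by exact_mod_cast (by linarith : a + 2 ≤ b))
  obtain ⟨φ1, p1⟩ := exists_hom a b ρ h1 hdeg s1 e1
  obtain ⟨φ2, p2⟩ := exists_hom a b ρ h1 hdeg s2 e2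
  obtain ⟨φ3, p3⟩ := exists_hom a b ρ h1 hdeg s3 e3
  exact ⟨φ1, φ2, φ3, by rw [p1, p2, p3]; exact k⟩
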